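/- In an MG-SPA, if v : S → ℝ satisfies v(s) ≥ (L v)(s) for every s ∈ S, then v(s) ≥ ⨆_{π} ⨅_{ρ} v_{π,ρ}(s) for every s ∈ S, where the supremum is over all agent policies π : S → (B → stdSimplex ℝ A) and the infimum is over all adversary policies ρ : S → stdSimplex ℝ B. (The first half of the proof of Theorem 4.4-(1).) -/

import Mathlib

open scoped BigOperators

section MGSPA

variable {S A B : Type*}

/-- The induced one-step expected reward of the joint policy `(π, ρ)`:
`r_{π,ρ}(s) = ∑ b, (ρ s) b * ∑ a, (π s b) a * r s a b`. -/
noncomputable def rPol [Fintype A] [Fintype B]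
    (r : S → A → B → ℝ)
    (π : S → B → stdSimplex ℝ A) (ρ : S → stdSimplex ℝ B) : S → ℝ :=
  fun s => ∑ b, (ρ s : B → ℝ) b * ∑ a, (π s b : A → ℝ) a * r s a b

/-- The induced state-transition matrix of the joint policy `(π, ρ)`:
`P_{π,ρ}(s, s') = ∑ b, (ρ s) b * ∑ a, (π s b) a * p s a b s'`. -/
noncomputable def PPol [Fintype A] [Fintype B]
    (p : S → A → B → S → ℝ)
    (π : S → B → stdSimplex ℝ A) (ρ : S → stdSimplex ℝ B) : Matrix S S ℝ :=
  fun s s' => ∑ b, (ρ s : B → ℝ) b * ∑ a, (π s b : A → ℝ) a * p s a b s'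

/-- The value function of the joint policy `(π, ρ)`:
`v_{π,ρ}(s) = ∑' t, γ^t * ((P_{π,ρ}^t) *ᵥ r_{π,ρ}) s`. -/
noncomputable def vFn [Fintype S] [DecidableEq S] [Fintype A] [Fintype B]
    (γ : ℝ) (r : S → A → B → ℝ) (p : S → A → B → S → ℝ)
    (π : S → B → stdSimplex ℝ A) (ρ : S → stdSimplex ℝ B) : S → ℝ :=
  fun s => ∑' t : ℕ, γ ^ t * (((PPol p π ρ) ^ t).mulVec (rPol r π ρ)) s

/-- The minimax (Shapley) Bellman operator of the MG-SPA. -/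
noncomputable def Lop [Fintype S] [Fintype A] [Fintype B]
    (γ : ℝ) (r : S → A → B → ℝ) (p : S → A → B → S → ℝ)
    (v : S → ℝ) : S → ℝ :=
  fun s => ⨆ x : B → stdSimplex ℝ A, ⨅ y : stdSimplex ℝ B,
    ∑ b, (y : B → ℝ) b * ∑ a, (x b : A → ℝ) a *
      (r s a b + γ * ∑ s', p s a b s' * v s')

end MGSPA

open Matrix in
/-- A row-stochastic matrix is nonexpansive for the sup norm. -/
lemma abs_mulVec_le_norm_of_mem_rowStochastic {S : Type*} [Fintype S] [DecidableEq S]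
    {P : Matrix S S ℝ} (hP : P ∈ rowStochastic ℝ S) (f : S → ℝ) (s : S) :
    |(P *ᵥ f) s| ≤ ‖f‖ := by
  calc |∑ s', P s s' * f s'| ≤ ∑ s', P s s' * ‖f‖ := by
        refine (Finset.abs_sum_le_sum_abs _ _).trans (Finset.sum_le_sum fun s' _ => ?_)
        rw [abs_mul, abs_of_nonneg (hP.1 s s')]
        exact mul_le_mul_of_nonneg_left (norm_le_pi_norm f s') (hP.1 s s')
    _ = ‖f‖ := by rw [← Finset.sum_mul, sum_row_of_mem_rowStochastic hP, one_mul]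

/-- The absolute value of an average is at most any bound on the absolute values averaged. -/
lemma abs_sum_stdSimplex_mul_le {ι : Type*} [Fintype ι] (y : stdSimplex ℝ ι) {f : ι → ℝ} {M : ℝ}
    (h : ∀ i, |f i| ≤ M) : |∑ i, (y : ι → ℝ) i * f i| ≤ M := by
  calc |∑ i, (y : ι → ℝ) i * f i| ≤ ∑ i, (y : ι → ℝ) i * M := by
        refine (Finset.abs_sum_le_sum_abs _ _).trans (Finset.sum_le_sum fun i _ => ?_)
        rw [abs_mul, abs_of_nonneg (stdSimplex.zero_le y i)]
        exact mul_le_mul_of_nonneg_left (h i) (y.2.1 i)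
    _ = M := by rw [← Finset.sum_mul, stdSimplex.sum_eq_one, one_mul]

/-- A joint average of a payoff table over a mixed joint action is bounded by the norm of the
table. -/
lemma abs_sum_stdSimplex_mul_sum_le_norm {A B : Type*} [Fintype A] [Fintype B]
    (x : B → stdSimplex ℝ A) (y : stdSimplex ℝ B) (q : A → B → ℝ) :
    |∑ b, (y : B → ℝ) b * ∑ a, (x b : A → ℝ) a * q a b| ≤ ‖q‖ :=
  abs_sum_stdSimplex_mul_le y fun b => abs_sum_stdSimplex_mul_le (x b) fun a =>
    (norm_le_pi_norm (q a) b).trans (norm_le_pi_norm q a)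

/-- Over a finite set, some point mass minimizes the average. -/
lemma exists_stdSimplex_sum_mul_le {ι : Type*} [Fintype ι] [Nonempty ι] (c : ι → ℝ) :
    ∃ y : stdSimplex ℝ ι, ∀ z : stdSimplex ℝ ι,
      ∑ i, (y : ι → ℝ) i * c i ≤ ∑ i, (z : ι → ℝ) i * c i := by
  classical
  obtain ⟨i₀, hi₀⟩ := Finite.exists_min c
  refine ⟨⟨Pi.single i₀ 1, single_mem_stdSimplex ℝ i₀⟩, fun z => ?_⟩
  calc ∑ i, Pi.single (M := fun _ => ℝ) i₀ 1 i * c i = ∑ i, (z : ι → ℝ) i * c i₀ := by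
        rw [← Finset.sum_mul, stdSimplex.sum_eq_one]
        simp [Pi.single_apply]
    _ ≤ _ := Finset.sum_le_sum fun i _ => mul_le_mul_of_nonneg_left (hi₀ i) (z.2.1 i)

section DiscountedSum

open Matrix Filter Topology

variable {S : Type*} [Fintype S] [DecidableEq S] {γ : ℝ} {P : Matrix S S ℝ}

lemma norm_discounted_mulVec_le (hγ0 : 0 ≤ γ) (hP : P ∈ rowStochastic ℝ S)
    (f : S → ℝ) (s : S) (t : ℕ) : ‖γ ^ t * ((P ^ t) *ᵥ f) s‖ ≤ γ ^ t * ‖f‖ := by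
  rw [norm_mul, Real.norm_of_nonneg (pow_nonneg hγ0 t)]
  exact mul_le_mul_of_nonneg_left
    (abs_mulVec_le_norm_of_mem_rowStochastic (pow_mem hP t) f s) (pow_nonneg hγ0 t)

lemma summable_discounted_mulVec (hγ0 : 0 ≤ γ) (hγ1 : γ < 1) (hP : P ∈ rowStochastic ℝ S)
    (f : S → ℝ) (s : S) : Summable fun t : ℕ => γ ^ t * ((P ^ t) *ᵥ f) s :=
  Summable.of_norm_bounded ((summable_geometric_of_lt_one hγ0 hγ1).mul_right ‖f‖)
    (norm_discounted_mulVec_le hγ0 hP f s)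

/-- A supersolution of the policy-evaluation equation dominates the discounted value. -/
lemma tsum_discounted_mulVec_le (hγ0 : 0 ≤ γ) (hγ1 : γ < 1) (hP : P ∈ rowStochastic ℝ S)
    {f v : S → ℝ} (h : ∀ s, f s + γ * (P *ᵥ v) s ≤ v s) (s : S) :
    ∑' t : ℕ, γ ^ t * ((P ^ t) *ᵥ f) s ≤ v s := by
  have step (t : ℕ) : γ ^ t * ((P ^ t) *ᵥ f) s ≤
      γ ^ t * ((P ^ t) *ᵥ v) s - γ ^ (t + 1) * ((P ^ (t + 1)) *ᵥ v) s := by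
    have hnn : 0 ≤ ((P ^ t) *ᵥ (v - f - γ • (P *ᵥ v))) s :=
      nonneg_mulVec_of_mem_rowStochastic (pow_mem hP t)
        (fun i => by simpa [sub_sub] using h i) s
    rw [mulVec_sub, mulVec_sub, mulVec_smul, mulVec_mulVec, ← pow_succ] at hnn
    simp only [Pi.sub_apply, Pi.smul_apply, smul_eq_mul] at hnn
    have := mul_nonneg (pow_nonneg hγ0 t) hnn
    rw [pow_succ γ]
    linarith
  have partial_le (n : ℕ) : ∑ t ∈ Finset.range n, γ ^ t * ((P ^ t) *ᵥ f) s ≤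
      v s - γ ^ n * ((P ^ n) *ᵥ v) s := by
    refine (Finset.sum_le_sum fun t _ => step t).trans_eq ?_
    rw [Finset.sum_range_sub' fun t => γ ^ t * ((P ^ t) *ᵥ v) s]
    simp
  have lim := (summable_discounted_mulVec hγ0 hγ1 hP v s).tendsto_atTop_zero.const_sub (v s)
  rw [sub_zero] at lim
  exact le_of_tendsto_of_tendsto'
    (summable_discounted_mulVec hγ0 hγ1 hP f s).hasSum.tendsto_sum_nat lim partial_le

end DiscountedSum

section MGSPA

variable {S A B : Type*} [Fintype S] [Fintype A] [Fintype B]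

lemma PPol_mem_rowStochastic [DecidableEq S] {p : S → A → B → S → ℝ}
    (hp0 : ∀ s a b s', 0 ≤ p s a b s') (hp1 : ∀ s a b, ∑ s', p s a b s' = 1)
    (π : S → B → stdSimplex ℝ A) (ρ : S → stdSimplex ℝ B) :
    PPol p π ρ ∈ Matrix.rowStochastic ℝ S := by
  refine Matrix.mem_rowStochastic_iff_sum.2 ⟨fun s s' => ?_, fun s => ?_⟩
  · exact Finset.sum_nonneg fun b _ => mul_nonneg ((ρ s).2.1 b) <|
      Finset.sum_nonneg fun a _ => mul_nonneg ((π s b).2.1 a) (hp0 s a b s')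
  · have inner (b : B) : ∑ s', ∑ a, (π s b : A → ℝ) a * p s a b s' = 1 := by
      rw [Finset.sum_comm]
      simp_rw [← Finset.mul_sum, hp1, mul_one]
      exact (π s b).2.2
    simp_rw [PPol]
    rw [Finset.sum_comm]
    simp_rw [← Finset.mul_sum, inner, mul_one]
    exact (ρ s).2.2

lemma rPol_add_PPol_mulVec (γ : ℝ) (r : S → A → B → ℝ) (p : S → A → B → S → ℝ)
    (π : S → B → stdSimplex ℝ A) (ρ : S → stdSimplex ℝ B) (v : S → ℝ) (s : S) :
    rPol r π ρ s + γ * ((PPol p π ρ).mulVec v) s =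
      ∑ b, (ρ s : B → ℝ) b * ∑ a, (π s b : A → ℝ) a *
        (r s a b + γ * ∑ s', p s a b s' * v s') := by
  have hP : ((PPol p π ρ).mulVec v) s =
      ∑ b, (ρ s : B → ℝ) b * ∑ a, (π s b : A → ℝ) a * ∑ s', p s a b s' * v s' := by
    simp only [Matrix.mulVec, dotProduct, PPol, Finset.sum_mul, Finset.mul_sum]
    rw [Finset.sum_comm]
    refine Finset.sum_congr rfl fun b _ => ?_
    rw [Finset.sum_comm]
    simp only [mul_assoc]
  rw [hP, rPol, Finset.mul_sum, ← Finset.sum_add_distrib]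
  refine Finset.sum_congr rfl fun b _ => ?_
  rw [mul_left_comm, ← mul_add, Finset.mul_sum, ← Finset.sum_add_distrib]
  congr 1
  exact Finset.sum_congr rfl fun a _ => by ring

/-- Against any agent decision rule, some adversary response keeps the one-step backup below
the minimax Bellman operator. -/
lemma exists_backup_le_Lop [Nonempty B] (γ : ℝ) (r : S → A → B → ℝ) (p : S → A → B → S → ℝ)
    (v : S → ℝ) (s : S) (x : B → stdSimplex ℝ A) :
    ∃ y : stdSimplex ℝ B, ∑ b, (y : B → ℝ) b * ∑ a, (x b : A → ℝ) a *
      (r s a b + γ * ∑ s', p s a b s' * v s') ≤ Lop γ r p v s := by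
  obtain ⟨y, hy⟩ := exists_stdSimplex_sum_mul_le fun b => ∑ a, (x b : A → ℝ) a *
      (r s a b + γ * ∑ s', p s a b s' * v s')
  have : Nonempty (stdSimplex ℝ B) := ⟨y⟩
  set q : A → B → ℝ := fun a b => r s a b + γ * ∑ s', p s a b s' * v s' with hq
  refine ⟨y, (le_ciInf hy).trans (le_ciSup
    (f := fun x : B → stdSimplex ℝ A => ⨅ y : stdSimplex ℝ B,
      ∑ b, (y : B → ℝ) b * ∑ a, (x b : A → ℝ) a * q a b) ⟨‖q‖, ?_⟩ x)⟩
  rintro _ ⟨x', rfl⟩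
  refine (ciInf_le ⟨-‖q‖, ?_⟩ y).trans
    (abs_le.1 (abs_sum_stdSimplex_mul_sum_le_norm x' y q)).2
  rintro _ ⟨y', rfl⟩
  exact (abs_le.1 (abs_sum_stdSimplex_mul_sum_le_norm x' y' q)).1

lemma bddBelow_range_vFn [DecidableEq S] {γ : ℝ} (hγ0 : 0 ≤ γ) (hγ1 : γ < 1)
    (r : S → A → B → ℝ) {p : S → A → B → S → ℝ}
    (hp0 : ∀ s a b s', 0 ≤ p s a b s') (hp1 : ∀ s a b, ∑ s', p s a b s' = 1)
    (π : S → B → stdSimplex ℝ A) (s : S) :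
    BddBelow (Set.range fun ρ : S → stdSimplex ℝ B => vFn γ r p π ρ s) := by
  refine ⟨-((1 - γ)⁻¹ * ‖r‖), ?_⟩
  rintro _ ⟨ρ, rfl⟩
  have hr : ‖rPol r π ρ‖ ≤ ‖r‖ := (pi_norm_le_iff_of_nonneg (norm_nonneg r)).2 fun s' =>
    (abs_sum_stdSimplex_mul_sum_le_norm (π s') (ρ s') (r s')).trans (norm_le_pi_norm r s')
  refine (abs_le.1 (tsum_of_norm_bounded
    (f := fun t : ℕ => γ ^ t * (((PPol p π ρ) ^ t).mulVec (rPol r π ρ)) s)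
    ((hasSum_geometric_of_lt_one hγ0 hγ1).mul_right ‖r‖) fun t => ?_)).1
  exact (norm_discounted_mulVec_le hγ0 (PPol_mem_rowStochastic hp0 hp1 π ρ) _ s t).trans
    (mul_le_mul_of_nonneg_left hr (pow_nonneg hγ0 t))

end MGSPA

/-- (First half of the proof of Theorem 4.4-(1).)  If `v ≥ L v` pointwise,
then `v` dominates the sup-inf value: `v s ≥ ⨆ π, ⨅ ρ, v_{π,ρ}(s)`. -/
theorem ge_Lop_implies_ge_optimal
    {S A B : Type*} [Fintype S] [DecidableEq S] [Nonempty S]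
    [Fintype A] [Nonempty A] [Fintype B] [Nonempty B]
    (γ : ℝ) (hγ0 : 0 ≤ γ) (hγ1 : γ < 1)
    (r : S → A → B → ℝ) (p : S → A → B → S → ℝ)
    (hp0 : ∀ s a b s', 0 ≤ p s a b s')
    (hp1 : ∀ s a b, ∑ s', p s a b s' = 1)
    (v : S → ℝ) (hv : ∀ s, Lop γ r p v s ≤ v s) :
    ∀ s : S,
      (⨆ π : S → B → stdSimplex ℝ A, ⨅ ρ : S → stdSimplex ℝ B, vFn γ r p π ρ s)
        ≤ v s := by
  intro s
  obtain ⟨a₀⟩ := ‹Nonempty A›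
  classical
  have : Nonempty (S → B → stdSimplex ℝ A) :=
    ⟨fun _ _ => ⟨Pi.single a₀ 1, single_mem_stdSimplex ℝ a₀⟩⟩
  refine ciSup_le fun π => ?_
  choose ρ hρ using fun s => exists_backup_le_Lop γ r p v s (π s)
  refine (ciInf_le (bddBelow_range_vFn hγ0 hγ1 r hp0 hp1 π s) ρ).trans ?_
  refine tsum_discounted_mulVec_le hγ0 hγ1 (PPol_mem_rowStochastic hp0 hp1 π ρ)
    (fun s' => ?_) s
  rw [rPol_add_PPol_mulVec]
  exact (hρ s').trans (hv s')
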